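/- arXiv:1509.09202 — 3 statements merged into one kernel-verified Lean document; each statement's English description precedes it below -/
import Mathlib

section
/- Let G be an infinite countable discrete residually finite amenable group acting continuously on a compact metric space (X,ρ) with the specification property. Then the set M_P(X,G) of periodic measures is dense in the set M(X,G) of G-invariant Borel probability measures in the weak* topology. -/
open scoped Pointwise
open MeasureTheory Filter Topology

/-- A Følner sequence: a sequence of nonempty finite subsets `F n` of `G` such that
`|F n ∆ K * F n| / |F n| → 0` for every finite `K ⊆ G`. -/
def IsFolnerSeq {G : Type*} [Group G] [DecidableEq G] (F : ℕ → Finset G) : Prop :=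
  (∀ n, (F n).Nonempty) ∧
    ∀ K : Finset G,
      Tendsto (fun n => ((symmDiff (F n) (K * F n)).card : ℝ) / (F n).card) atTop (𝓝 0)

/-- A countable group is amenable if it admits a Følner sequence. -/
def IsAmenableGroup (G : Type*) [Group G] [DecidableEq G] : Prop :=
  ∃ F : ℕ → Finset G, IsFolnerSeq F

/-- A group is residually finite if the intersection of all its finite-index normal
subgroups is trivial. -/
def IsResiduallyFinite (G : Type*) [Group G] : Prop :=
  (⨅ H ∈ {H : Subgroup G | H.Normal ∧ H.FiniteIndex}, H) = ⊥

/-- The specification property for an action of `G` on `X`, with respect to an explicitly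
given metric `d` on `X` : for every `ε > 0` there is a nonempty finite `F ⊆ G` such that for
all finite `F₁, …, F_m ⊆ G` with `F * Fᵢ ∩ F_j = ∅` for `i ≠ j`, and every subgroup `G'`
with `F * Fᵢ ∩ F_j (G' \ {1}) = ∅` for all `i, j`, and any points `x¹, …, x^m`, there is `y`
with `d (s • xⁱ) (s • y) ≤ ε` for all `s ∈ Fᵢ`, which is fixed by every element of `G'`. -/
def HasSpecificationDist (G X : Type*) [Group G] [DecidableEq G] [MulAction G X]
    (d : X → X → ℝ) : Prop :=
  ∀ ε : ℝ, 0 < ε → ∃ F : Finset G, F.Nonempty ∧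
    ∀ (m : ℕ) (Fs : Fin m → Finset G),
      (∀ i j : Fin m, i ≠ j → Disjoint (F * Fs i) (Fs j)) →
      ∀ G' : Subgroup G,
        (∀ i j : Fin m,
          Disjoint ((F * Fs i : Finset G) : Set G) ((Fs j : Set G) * ((G' : Set G) \ {1}))) →
        ∀ x : Fin m → X, ∃ y : X,
          (∀ i : Fin m, ∀ s ∈ Fs i, d (s • x i) (s • y) ≤ ε) ∧
          ∀ s ∈ G', s • y = y

/-- The set `M(X,G)` of `G`-invariant Borel probability measures on `X`. -/
def invariantProbs (G X : Type*) [Group G] [MulAction G X] [MeasurableSpace X] :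
    Set (ProbabilityMeasure X) :=
  {μ | ∀ g : G, (μ : Measure X).map (fun x => g • x) = (μ : Measure X)}

/-- The set `M_P(X,G)` of periodic measures: uniform measures on finite orbits. -/
noncomputable def periodicProbs (G X : Type*) [Group G] [MulAction G X]
    [MeasurableSpace X] : Set (ProbabilityMeasure X) :=
  {μ | ∃ (x : X) (h : (MulAction.orbit G x).Finite),
    (μ : Measure X) = (h.toFinset.card : ENNReal)⁻¹ • ∑ p ∈ h.toFinset, Measure.dirac p}

lemma IsFolnerSeq.exists_large_core {G : Type*} [Group G] [DecidableEq G] {F : ℕ → Finset G}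
    (hF : IsFolnerSeq F) (K : Finset G) {η : ℝ} (hη : 0 < η) :
    ∃ A : Finset G, A.Nonempty ∧
      ((A.filter fun a => ¬ ∀ k ∈ K, k * a ∈ A).card : ℝ) ≤ η * A.card := by
  have hη' : 0 < η / (K.card + 1) := by positivity
  obtain ⟨n, hn⟩ := ((hF.2 K).eventually_lt_const hη').exists
  refine ⟨F n, hF.1 n, ?_⟩
  have hpos : (0 : ℝ) < (F n).card := by exact_mod_cast (hF.1 n).card_pos
  rw [div_lt_iff₀ hpos] at hn
  have hsub : (F n).filter (fun a => ¬ ∀ k ∈ K, k * a ∈ F n) ⊆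
      K.biUnion fun k => (symmDiff (F n) (K * F n)).image fun b => k⁻¹ * b := by
    intro a ha
    simp only [Finset.mem_filter, not_forall] at ha
    obtain ⟨haA, k, hk, hka⟩ := ha
    simp only [Finset.mem_biUnion, Finset.mem_image]
    exact ⟨k, hk, k * a, Finset.mem_symmDiff.2 (Or.inr ⟨Finset.mul_mem_mul hk haA, hka⟩),
      by simp⟩
  have hcard := (Finset.card_le_card hsub).trans (Finset.card_biUnion_le_card_mul K _ _
    fun k _ => Finset.card_image_le)
  have hcard' : (((F n).filter (fun a => ¬ ∀ k ∈ K, k * a ∈ F n)).card : ℝ) ≤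
      K.card * (symmDiff (F n) (K * F n)).card := by exact_mod_cast hcard
  calc _ ≤ (K.card : ℝ) * (symmDiff (F n) (K * F n)).card := hcard'
    _ ≤ (K.card + 1 : ℝ) * (η / (K.card + 1) * (F n).card) := by gcongr; linarith
    _ = η * (F n).card := by field_simp

lemma IsResiduallyFinite.exists_normal_finiteIndex {G : Type*} [Group G]
    (hG : IsResiduallyFinite G) (E : Finset G) :
    ∃ H : Subgroup G, H.Normal ∧ H.FiniteIndex ∧ ∀ e ∈ E, e ∈ H → e = 1 := by
  classical
  induction E using Finset.induction_on with
  | empty => exact ⟨⊤, inferInstance, inferInstance, by simp⟩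
  | insert g E _ ih =>
    obtain ⟨H, hn, hf, hE⟩ := ih
    by_cases hg : g = 1
    · exact ⟨H, hn, hf, by simpa [hg] using hE⟩
    · have hmem : g ∉ (⨅ H ∈ {H : Subgroup G | H.Normal ∧ H.FiniteIndex}, H) := by
        rw [hG]; simpa using hg
      simp only [Subgroup.mem_iInf, not_forall, Set.mem_ofPred_eq] at hmem
      obtain ⟨L, ⟨hLn, hLf⟩, hL⟩ := hmem
      refine ⟨H ⊓ L, inferInstance, inferInstance, ?_⟩
      intro e he heH
      rcases Finset.mem_insert.1 he with rfl | he
      · exact absurd heH.2 hL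
      · exact hE e he heH.1

/-- In a uniformly random enumeration, the first element of `W` lies in `V ⊆ W` with
probability `|V| / |W|`. -/
lemma card_equiv_first_mem {Q : Type*} [Fintype Q] [DecidableEq Q] {n : ℕ}
    {V W : Finset Q} (hVW : V ⊆ W) :
    (Finset.univ.filter fun σ : Q ≃ Fin n => ∃ v ∈ V, ∀ w ∈ W, σ v ≤ σ w).card * W.card ≤
      V.card * Fintype.card (Q ≃ Fin n) := by
  set N : Q → Finset (Q ≃ Fin n) :=
    fun v => Finset.univ.filter fun σ : Q ≃ Fin n => ∀ w ∈ W, σ v ≤ σ w with hN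
  have hle : ∀ v ∈ W, ∀ w ∈ W, (N v).card ≤ (N w).card := by
    intro v hv w hw
    refine Finset.card_le_card_of_injOn (fun σ => (Equiv.swap v w).trans σ) ?_ ?_
    · intro σ hσ
      simp only [hN, Finset.coe_filter, Finset.mem_univ, true_and, Set.mem_ofPred_eq,
        Equiv.trans_apply, Equiv.swap_apply_right] at hσ ⊢
      intro u hu
      apply hσ
      rcases eq_or_ne u v with rfl | huv
      · simpa using hw
      rcases eq_or_ne u w with rfl | huw
      · simpa using hv
      · rwa [Equiv.swap_apply_of_ne_of_ne huv huw]
    · intro σ _ τ _ h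
      ext q
      have := congrArg (fun ρ : Q ≃ Fin n => ρ (Equiv.swap v w q)) h
      simpa using congrArg Fin.val this
  have hdisj : (W : Set Q).PairwiseDisjoint N := by
    intro v hv w hw hvw
    rw [Function.onFun, Finset.disjoint_left]
    intro σ h1 h2
    simp only [hN, Finset.mem_filter, Finset.mem_univ, true_and] at h1 h2
    exact hvw (σ.injective (le_antisymm (h1 w hw) (h2 v hv)))
  have hsum : ∑ w ∈ W, (N w).card ≤ Fintype.card (Q ≃ Fin n) := by
    rw [← Finset.card_biUnion hdisj]
    exact Finset.card_le_univ _
  have hfilter : (Finset.univ.filter fun σ : Q ≃ Fin n => ∃ v ∈ V, ∀ w ∈ W, σ v ≤ σ w) ⊆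
      V.biUnion N := by
    intro σ hσ
    simpa [hN] using hσ
  calc _ ≤ (∑ v ∈ V, (N v).card) * W.card :=
        Nat.mul_le_mul_right _ ((Finset.card_le_card hfilter).trans Finset.card_biUnion_le)
    _ = ∑ v ∈ V, W.card * (N v).card := by rw [Finset.sum_mul]; simp [mul_comm]
    _ ≤ ∑ v ∈ V, Fintype.card (Q ≃ Fin n) := by
        refine Finset.sum_le_sum fun v hv => le_trans ?_ hsum
        rw [← smul_eq_mul]
        exact Finset.card_nsmul_le_sum _ _ _ fun w hw => hle v (hVW hv) w hw
    _ = _ := by simp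

lemma exists_equiv_first_mem_le {Q : Type*} [Fintype Q] [DecidableEq Q] {V W : Q → Finset Q}
    (hVW : ∀ x, V x ⊆ W x) (hW : ∀ x, (W x).Nonempty) {η : ℝ}
    (hη : ∀ x, ((V x).card : ℝ) ≤ η * (W x).card) :
    ∃ σ : Q ≃ Fin (Fintype.card Q),
      ((Finset.univ.filter fun x => ∃ v ∈ V x, ∀ w ∈ W x, σ v ≤ σ w).card : ℝ) ≤
        η * Fintype.card Q := by
  let P : (Q ≃ Fin (Fintype.card Q)) → Q → Prop := fun σ x => ∃ v ∈ V x, ∀ w ∈ W x, σ v ≤ σ w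
  have hx : ∀ x, ((Finset.univ.filter fun σ => P σ x).card : ℝ) ≤
      η * Fintype.card (Q ≃ Fin (Fintype.card Q)) := by
    intro x
    have hpos : (0 : ℝ) < (W x).card := by exact_mod_cast (hW x).card_pos
    have h : ((Finset.univ.filter fun σ => P σ x).card : ℝ) * (W x).card ≤
        (V x).card * Fintype.card (Q ≃ Fin (Fintype.card Q)) := by
      exact_mod_cast card_equiv_first_mem (hVW x)
    refine le_of_mul_le_mul_right (h.trans ?_) hpos
    calc _ ≤ η * (W x).card * (Fintype.card (Q ≃ Fin (Fintype.card Q)) : ℝ) := by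
          gcongr; exact hη x
      _ = _ := by ring
  have hne : (Finset.univ : Finset (Q ≃ Fin (Fintype.card Q))).Nonempty :=
    ⟨Fintype.equivFin Q, Finset.mem_univ _⟩
  have hsum : ∑ σ : Q ≃ Fin (Fintype.card Q), ((Finset.univ.filter fun x => P σ x).card : ℝ) ≤
      ∑ _σ : Q ≃ Fin (Fintype.card Q), η * Fintype.card Q := by
    have hcomm : ∑ σ : Q ≃ Fin (Fintype.card Q), (Finset.univ.filter fun x => P σ x).card =
        ∑ x, (Finset.univ.filter fun σ => P σ x).card :=
      Finset.sum_card_bipartiteAbove_eq_sum_card_bipartiteBelow P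
    calc _ = ∑ x, ((Finset.univ.filter fun σ => P σ x).card : ℝ) := by exact_mod_cast hcomm
      _ ≤ ∑ _x : Q, η * Fintype.card (Q ≃ Fin (Fintype.card Q)) :=
          Finset.sum_le_sum fun x _ => hx x
      _ = _ := by
          simp only [Finset.sum_const, Finset.card_univ, nsmul_eq_mul]; ring
  obtain ⟨σ, -, hσ⟩ := Finset.exists_le_of_sum_le hne hsum
  exact ⟨σ, hσ⟩
/-- Points can be selected one at a time so that sums of centred functions stay as small as
independence would predict. -/
lemma exists_sum_sq_le_of_integral_eq_zero {X ι κ : Type*} [MeasurableSpace X]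
    (μ : Measure X) [IsProbabilityMeasure μ] (t : Finset κ) (g : κ → ι → X → ℝ)
    (hg : ∀ k i, Integrable (g k i) μ) (hg0 : ∀ k i, ∫ x, g k i x ∂μ = 0)
    {C : ι → ℝ} (hC : ∀ i x, ∑ k ∈ t, (g k i x) ^ 2 ≤ C i) (s : Finset ι) :
    ∃ z : ι → X, ∑ k ∈ t, (∑ i ∈ s, g k i (z i)) ^ 2 ≤ ∑ i ∈ s, C i := by
  classical
  induction s using Finset.induction_on with
  | empty =>
    obtain ⟨x⟩ := μ.nonempty_of_neZero
    exact ⟨fun _ => x, by simp⟩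
  | insert i s his ih =>
    obtain ⟨z, hz⟩ := ih
    set P : κ → ℝ := fun k => ∑ j ∈ s, g k j (z j)
    have hint : ∀ k, Integrable (fun x => P k * g k i x) μ := fun k =>
      (hg k i).const_mul _
    obtain ⟨x, hx⟩ := exists_le_integral (μ := μ) (f := fun x => ∑ k ∈ t, P k * g k i x)
      (integrable_finsetSum _ fun k _ => hint k)
    have h0 : ∫ x, ∑ k ∈ t, P k * g k i x ∂μ = 0 := by
      rw [integral_finsetSum _ fun k _ => hint k]
      simp [integral_const_mul, hg0]
    rw [h0] at hx
    refine ⟨Function.update z i x, ?_⟩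
    have hs : ∀ k, ∑ j ∈ s, g k j (Function.update z i x j) = P k := fun k =>
      Finset.sum_congr rfl fun j hj => by
        rw [Function.update_of_ne (ne_of_mem_of_not_mem hj his)]
    simp only [Finset.sum_insert his, Function.update_self, hs]
    calc ∑ k ∈ t, (g k i x + P k) ^ 2
        = ∑ k ∈ t, (g k i x) ^ 2 + 2 * ∑ k ∈ t, P k * g k i x + ∑ k ∈ t, P k ^ 2 := by
          rw [Finset.mul_sum, ← Finset.sum_add_distrib, ← Finset.sum_add_distrib]
          exact Finset.sum_congr rfl fun k _ => by ring
      _ ≤ C i + ∑ j ∈ s, C j := by linarith [hC i x]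

lemma out_smul_eq_smul {G X : Type*} [Group G] [MulAction G X] {H : Subgroup G} {y : X}
    (hy : ∀ h ∈ H, h • y = y) (g : G) : (g : G ⧸ H).out • y = g • y := by
  obtain ⟨h, hh⟩ := QuotientGroup.mk_out_eq_mul H g
  rw [hh, mul_smul, hy h h.2]

/-- A point fixed by a finite-index subgroup carries a periodic measure, which is computed by
averaging over the cosets. -/
lemma exists_periodicProbs_integral_eq {G X : Type*} [Group G] [MulAction G X]
    [MeasurableSpace X] [MeasurableSingletonClass X] {H : Subgroup G} [Fintype (G ⧸ H)] {y : X}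
    (hy : ∀ h ∈ H, h • y = y) :
    ∃ ν ∈ periodicProbs G X, ∀ f : X → ℝ,
      (Fintype.card (G ⧸ H) : ℝ) * ∫ x, f x ∂(ν : Measure X) =
        ∑ q : G ⧸ H, f (q.out • y) := by
  classical
  set φ : G ⧸ H → X := fun q => q.out • y with hφ
  have hφmk : ∀ g : G, φ (g : G ⧸ H) = g • y := out_smul_eq_smul hy
  have hφsmul : ∀ (g : G) q, φ (g • q) = g • φ q := by
    intro g q
    induction q using QuotientGroup.induction_on with
    | H a => rw [hφmk, ← mul_smul, ← hφmk]; rfl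
  have hrange : MulAction.orbit G y = Set.range φ := by
    ext p
    constructor
    · rintro ⟨g, rfl⟩
      exact ⟨g, hφmk g⟩
    · rintro ⟨q, rfl⟩
      exact ⟨q.out, rfl⟩
  have hfin : (MulAction.orbit G y).Finite := hrange ▸ Set.finite_range φ
  set O := hfin.toFinset with hO
  have hφO : ∀ q, φ q ∈ O := fun q => by simp [hO, hrange]
  have hle : ∀ p p', p ∈ O → p' ∈ O →
      (Finset.univ.filter fun q => φ q = p).card ≤
        (Finset.univ.filter fun q => φ q = p').card := by
    intro p p' hp hp'
    simp only [hO, Set.Finite.mem_toFinset] at hp hp'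
    obtain ⟨a, rfl⟩ := hp
    obtain ⟨b, rfl⟩ := hp'
    refine Finset.card_le_card_of_injOn (fun q => (b * a⁻¹) • q) ?_
      (MulAction.injective (b * a⁻¹)).injOn
    intro q hq
    have hq' : φ q = a • y := by simpa using hq
    simp [hφsmul, hq', mul_smul]
  have hyO : y ∈ O := by simp [hO]
  have hfib : ∀ p ∈ O, (Finset.univ.filter fun q => φ q = p).card =
      (Finset.univ.filter fun q => φ q = y).card := fun p hp =>
    le_antisymm (hle _ _ hp hyO) (hle _ _ hyO hp)
  have hOpos : 0 < O.card := Finset.card_pos.2 ⟨y, hyO⟩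
  have hcard : Fintype.card (G ⧸ H) =
      O.card * (Finset.univ.filter fun q => φ q = y).card := by
    rw [← Finset.card_univ, Finset.card_eq_sum_card_fiberwise (f := φ) (t := (O : Finset X))
      (fun q _ => hφO q), Finset.sum_congr rfl hfib]
    simp
  have hsum : ∀ f : X → ℝ, ∑ q, f (φ q) =
      (Finset.univ.filter fun q => φ q = y).card * ∑ p ∈ O, f p := by
    intro f
    rw [← Finset.sum_fiberwise_of_maps_to (fun q _ => hφO q), Finset.mul_sum]
    refine Finset.sum_congr rfl fun p hp => ?_
    rw [← hfib p hp, ← nsmul_eq_mul]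
    refine Finset.sum_eq_card_nsmul fun q hq => ?_
    rw [(Finset.mem_filter.1 hq).2]
  set m : Measure X := (O.card : ENNReal)⁻¹ • ∑ p ∈ O, Measure.dirac p with hm
  have hprob : IsProbabilityMeasure m := by
    constructor
    simp only [hm, Measure.smul_apply, Measure.finsetSum_apply, measure_univ, Finset.sum_const,
      smul_eq_mul, nsmul_eq_mul, mul_one]
    exact ENNReal.inv_mul_cancel (by exact_mod_cast hOpos.ne') (ENNReal.natCast_ne_top _)
  refine ⟨⟨m, hprob⟩, ⟨y, hfin, rfl⟩, fun f => ?_⟩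
  change _ * ∫ x, f x ∂m = ∑ q, f (φ q)
  rw [hsum, hm, integral_smul_measure, integral_finsetSum_measure]
  · have : (O.card : ℝ) ≠ 0 := by exact_mod_cast hOpos.ne'
    simp only [integral_dirac, hcard, ENNReal.toReal_inv, ENNReal.toReal_natCast, smul_eq_mul]
    push_cast
    field_simp
  · intro p _
    exact integrable_dirac (by simp)

lemma exists_forall_dist_le {X ι : Type*} [PseudoMetricSpace X] [CompactSpace X]
    (t : Finset ι) (f : ι → X → ℝ) (hf : ∀ i ∈ t, Continuous (f i)) {ε : ℝ} (hε : 0 < ε) :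
    ∃ δ > 0, ∀ i ∈ t, ∀ x y, dist x y ≤ δ → |f i x - f i y| ≤ ε := by
  have hev : ∀ᶠ δ in 𝓝[>] (0 : ℝ), ∀ i ∈ t, ∀ x y, dist x y ≤ δ → |f i x - f i y| ≤ ε := by
    rw [Finset.eventually_all]
    intro i hi
    obtain ⟨δ, hδ, h⟩ := Metric.uniformContinuous_iff.1
      (CompactSpace.uniformContinuous_of_continuous (hf i hi)) ε hε
    filter_upwards [Ioo_mem_nhdsGT hδ] with r hr x y hxy
    exact (h (hxy.trans_lt hr.2)).le
  obtain ⟨δ, h, hδ⟩ := (hev.and self_mem_nhdsWithin).exists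
  exact ⟨δ, hδ, h⟩

lemma exists_periodicProbs_integral_close {G X : Type*} [Group G] [Infinite G] [DecidableEq G]
    [MetricSpace X] [CompactSpace X] [MeasurableSpace X] [BorelSpace X]
    [MulAction G X] [ContinuousConstSMul G X]
    (hRF : IsResiduallyFinite G) (hAm : IsAmenableGroup G)
    (hSpec : HasSpecificationDist G X dist) {μ : ProbabilityMeasure X}
    (hμ : μ ∈ invariantProbs G X) (t : Finset (BoundedContinuousFunction X ℝ)) {ε : ℝ}
    (hε : 0 < ε) :
    ∃ ν ∈ periodicProbs G X, ∀ f ∈ t,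
      |∫ x, f x ∂(ν : Measure X) - ∫ x, f x ∂(μ : Measure X)| ≤ ε := by
  classical
  obtain ⟨Φ, hΦ⟩ := hAm
  have hε3 : 0 < ε / 3 := by positivity
  obtain ⟨M, hM1, hM⟩ : ∃ M : ℝ, 1 ≤ M ∧ ∀ f ∈ t, ∀ x, |f x| ≤ M := by
    refine ⟨1 + ∑ f ∈ t, ‖f‖, by simpa using Finset.sum_nonneg fun f _ => norm_nonneg f, ?_⟩
    intro f hf x
    have h1 := f.norm_coe_le_norm x
    have h2 := Finset.single_le_sum (f := fun f : BoundedContinuousFunction X ℝ => ‖f‖)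
      (fun f _ => norm_nonneg f) hf
    rw [Real.norm_eq_abs] at h1
    linarith
  have hM0 : 0 < M := by linarith
  set c : BoundedContinuousFunction X ℝ → ℝ := fun f => ∫ x, f x ∂(μ : Measure X) with hc
  have hcM : ∀ f ∈ t, |c f| ≤ M := by
    intro f hf
    have := norm_integral_le_of_norm_le_const (μ := (μ : Measure X)) (f := f) (C := M)
      (ae_of_all _ fun x => hM f hf x)
    simpa using this
  obtain ⟨δ, hδ, hδt⟩ := exists_forall_dist_le t (fun f => (f : X → ℝ))
    (fun f _ => f.continuous) hε3
  obtain ⟨F, -, hF⟩ := hSpec δ hδ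
  obtain ⟨A, hAne, hA⟩ := hΦ.exists_large_core (F ∪ F⁻¹) (η := ε / (6 * M)) (by positivity)
  set C : ℝ := t.card * (2 * M * A.card) ^ 2 with hC
  obtain ⟨N, hN⟩ := exists_nat_ge (C / (ε / 3) ^ 2)
  obtain ⟨B, hAB, hBN⟩ := Infinite.exists_superset_card_eq A (max N A.card) (le_max_right _ _)
  obtain ⟨H, hHn, hHf, hH⟩ := hRF.exists_normal_finiteIndex (B⁻¹ * B)
  have hinj : Set.InjOn (fun g : G => (g : G ⧸ H)) B := by
    intro a ha b hb hab
    have := hH (a⁻¹ * b) (Finset.mul_mem_mul (Finset.inv_mem_inv ha) hb)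
      (QuotientGroup.eq.1 hab)
    exact (inv_mul_eq_one.1 this)
  have hinjA : ∀ a ∈ A, ∀ b ∈ A, (a : G ⧸ H) = b → a = b := fun a ha b hb h =>
    hinj (hAB ha) (hAB hb) h
  let _ : Fintype (G ⧸ H) := H.fintypeQuotientOfFiniteIndex
  set n := Fintype.card (G ⧸ H) with hn
  have hn0 : (0 : ℝ) < n := by exact_mod_cast Fintype.card_pos
  have hNn : (N : ℝ) ≤ n := by
    have : B.card ≤ n := by
      rw [← Finset.card_image_of_injOn hinj]; exact Finset.card_le_univ _
    exact_mod_cast (le_max_left _ _).trans (hBN.symm.le.trans this)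
  set bad := A.filter fun a => ¬ ∀ k ∈ F ∪ F⁻¹, k * a ∈ A with hbad
  have hinjx : ∀ x : G ⧸ H, Set.InjOn (fun a : G => (a : G ⧸ H)⁻¹ * x) A := by
    intro x a ha b hb hab
    exact hinjA a ha b hb (inv_injective (mul_right_cancel hab))
  obtain ⟨σ, hσ⟩ := exists_equiv_first_mem_le
    (V := fun x : G ⧸ H => bad.image fun a : G => (a : G ⧸ H)⁻¹ * x)
    (W := fun x : G ⧸ H => A.image fun a : G => (a : G ⧸ H)⁻¹ * x)
    (fun x => Finset.image_subset_image (Finset.filter_subset _ _))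
    (fun x => hAne.image _) (η := ε / (6 * M)) (fun x => by
      rw [Finset.card_image_of_injOn (hinjx x)]
      exact le_trans (by exact_mod_cast Finset.card_image_le) hA)
  set q : Fin n → G ⧸ H := fun i => σ.symm i with hq
  set S : Fin n → Finset G := fun i => A.filter fun a => (∀ k ∈ F ∪ F⁻¹, k * a ∈ A) ∧
    ∀ b ∈ A, i ≤ σ ((b : G ⧸ H)⁻¹ * ((a : G ⧸ H) * q i)) with hS
  have hSA : ∀ i, ∀ a ∈ S i, a ∈ A := fun i a ha => (Finset.mem_filter.1 ha).1
  have hcore : ∀ i, ∀ a ∈ S i, ∀ k ∈ F ∪ F⁻¹, k * a ∈ A := fun i a ha =>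
    (Finset.mem_filter.1 ha).2.1
  have hfirst : ∀ i j, ∀ a ∈ S i, ∀ b ∈ A,
      (a : G ⧸ H) * q i = (b : G ⧸ H) * q j → i ≤ j := by
    intro i j a ha b hb hab
    have := (Finset.mem_filter.1 ha).2.2 b hb
    rw [hab] at this
    simpa [hq] using this
  have hqout : ∀ i, (((q i).out : G) : G ⧸ H) = q i := fun i => QuotientGroup.out_eq' _
  have hmeet : ∀ i j, ∀ k ∈ F, ∀ a ∈ S i, ∀ b ∈ S j,
      (k : G ⧸ H) * ((a : G ⧸ H) * q i) = (b : G ⧸ H) * q j → i = j ∧ k * a = b := by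
    intro i j k hk a ha b hb h
    have hka : k * a ∈ A := hcore i a ha k (Finset.mem_union_left _ hk)
    have hkb : k⁻¹ * b ∈ A :=
      hcore j b hb k⁻¹ (Finset.mem_union_right _ (Finset.inv_mem_inv hk))
    have hij : i ≤ j := hfirst i j a ha _ hkb (by
      rw [QuotientGroup.mk_mul, QuotientGroup.mk_inv, mul_assoc, ← h, inv_mul_cancel_left])
    have hji : j ≤ i := hfirst j i b hb _ hka (by
      rw [QuotientGroup.mk_mul, mul_assoc, h])
    obtain rfl := le_antisymm hij hji
    refine ⟨rfl, hinjA _ hka _ (hSA i b hb) ?_⟩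
    rw [QuotientGroup.mk_mul]
    rw [← mul_assoc] at h
    exact mul_right_cancel h
  -- selection of the points
  have hgint : ∀ (f : BoundedContinuousFunction X ℝ) (a : G),
      Integrable (fun x => f (a • x)) (μ : Measure X) := fun f a =>
    (f.compContinuous ⟨fun x => a • x, continuous_const_smul a⟩).integrable _
  have hgint' : ∀ (f : BoundedContinuousFunction X ℝ) (a : G),
      Integrable (fun x => f (a • x) - c f) (μ : Measure X) := fun f a =>
    (hgint f a).sub (integrable_const _)
  have hinv : ∀ (f : BoundedContinuousFunction X ℝ) (a : G),
      ∫ x, f (a • x) ∂(μ : Measure X) = c f := by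
    intro f a
    have := integral_map (μ := (μ : Measure X)) (φ := fun x => a • x)
      (continuous_const_smul a).measurable.aemeasurable
      (f := f) f.continuous.aestronglyMeasurable
    rw [hμ a] at this
    exact this.symm
  obtain ⟨z, hz⟩ := exists_sum_sq_le_of_integral_eq_zero (μ : Measure X) t
    (fun f (i : Fin n) x => ∑ a ∈ S i, (f (a • x) - c f))
    (fun f i => integrable_finsetSum _ fun a _ => hgint' f a)
    (fun f i => by
      rw [integral_finsetSum _ fun a _ => hgint' f a]
      refine Finset.sum_eq_zero fun a _ => ?_
      rw [integral_sub (hgint f a) (integrable_const _), hinv]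
      simp)
    (C := fun _ => C) (fun i x => by
      rw [hC, ← nsmul_eq_mul]
      refine Finset.sum_le_card_nsmul _ _ _ fun f hf => ?_
      rw [← sq_abs]
      refine pow_le_pow_left₀ (abs_nonneg _) ?_ 2
      calc _ ≤ ∑ a ∈ S i, |f (a • x) - c f| := Finset.abs_sum_le_sum_abs _ _
        _ ≤ ∑ a ∈ S i, 2 * M := Finset.sum_le_sum fun a _ => by
            have := abs_sub (f (a • x)) (c f)
            linarith [hM f hf (a • x), hcM f hf]
        _ = (S i).card * (2 * M) := by simp
        _ ≤ A.card * (2 * M) := by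
            gcongr; exact Finset.filter_subset _ _
        _ = _ := by ring) Finset.univ
  have hz' : ∀ f ∈ t, |∑ i, ∑ a ∈ S i, (f (a • z i) - c f)| ≤ ε / 3 * n := by
    intro f hf
    refine abs_le_of_sq_le_sq ?_ (by positivity)
    have h1 := Finset.single_le_sum
      (f := fun f : BoundedContinuousFunction X ℝ => (∑ i, ∑ a ∈ S i, (f (a • z i) - c f)) ^ 2)
      (fun f _ => sq_nonneg _) hf
    refine (h1.trans hz).trans ?_
    have h2 : C ≤ n * (ε / 3) ^ 2 := (div_le_iff₀ (by positivity)).1 (hN.trans hNn)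
    calc ∑ _i : Fin n, C = n * C := by simp
      _ ≤ n * (n * (ε / 3) ^ 2) := by gcongr
      _ = _ := by ring
  -- the shadowing periodic point
  obtain ⟨y, hyS, hyH⟩ := hF n (fun i => S i * {(q i).out})
    (by
      intro i j hij
      rw [Finset.disjoint_left]
      intro g hg hg'
      simp only [Finset.mem_mul, Finset.mem_singleton] at hg hg'
      obtain ⟨k, hk, _, ⟨a, ha, _, rfl, rfl⟩, rfl⟩ := hg
      obtain ⟨b, hb, _, rfl, hg'⟩ := hg'
      have := congrArg (fun g : G => (g : G ⧸ H)) hg'.symm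
      simp only [QuotientGroup.mk_mul, hqout] at this
      exact hij (hmeet i j k hk a ha b hb this).1)
    H
    (by
      intro i j
      rw [Set.disjoint_left]
      intro g hg hg'
      simp only [Finset.mem_coe, Finset.mem_mul, Finset.mem_singleton] at hg
      obtain ⟨k, hk, _, ⟨a, ha, _, rfl, rfl⟩, rfl⟩ := hg
      obtain ⟨_, hb', h, ⟨hh, hh1⟩, hg'⟩ := hg'
      simp only [Finset.mem_coe, Finset.mem_mul, Finset.mem_singleton] at hb'
      obtain ⟨b, hb, _, rfl, rfl⟩ := hb'
      have := congrArg (fun g : G => (g : G ⧸ H)) hg'.symm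
      simp only [QuotientGroup.mk_mul, hqout, (QuotientGroup.eq_one_iff h).2 hh,
        mul_one] at this
      obtain ⟨rfl, rfl⟩ := hmeet i j k hk a ha b hb this
      apply hh1
      simpa [mul_assoc] using hg')
    (fun i => ((q i).out)⁻¹ • z i)
  obtain ⟨ν, hν, hνf⟩ := exists_periodicProbs_integral_eq (H := H) hyH
  refine ⟨ν, hν, fun f hf => ?_⟩
  set u : G ⧸ H → ℝ := fun x => f (x.out • y) - c f with hu
  have husum : ∑ x, u x = n * (∫ x, f x ∂(ν : Measure X) - c f) := by
    rw [mul_sub, hνf, hu, Finset.sum_sub_distrib]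
    simp [hn]
  set R := (Finset.univ.sigma S).image
    (fun p : (_ : Fin n) × G => (p.2 : G ⧸ H) * q p.1) with hR
  have hRinj : Set.InjOn (fun p : (_ : Fin n) × G => (p.2 : G ⧸ H) * q p.1)
      (Finset.univ.sigma S) := by
    rintro ⟨i, a⟩ ha ⟨j, b⟩ hb hab
    simp only [Finset.coe_sigma, Set.mem_sigma_iff, Finset.mem_coe] at ha hb hab
    obtain rfl := le_antisymm (hfirst i j a ha.2 b (hSA j b hb.2) hab)
      (hfirst j i b hb.2 a (hSA i a ha.2) hab.symm)
    rw [hinjA a (hSA i a ha.2) b (hSA i b hb.2) (mul_right_cancel hab)]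
  have hRsum : ∀ w : G ⧸ H → ℝ, ∑ x ∈ R, w x = ∑ i, ∑ a ∈ S i, w ((a : G ⧸ H) * q i) := by
    intro w
    rw [hR, Finset.sum_image hRinj, Finset.sum_sigma]
  have hRc : ((Rᶜ).card : ℝ) ≤ ε / (6 * M) * n := by
    refine le_trans ?_ hσ
    refine Nat.cast_le.2 (Finset.card_le_card fun x hx => ?_)
    rw [Finset.mem_filter]
    refine ⟨Finset.mem_univ _, ?_⟩
    obtain ⟨a, ha, hamin⟩ := A.exists_min_image (fun a => σ ((a : G ⧸ H)⁻¹ * x)) hAne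
    refine ⟨(a : G ⧸ H)⁻¹ * x, Finset.mem_image_of_mem _ ?_, ?_⟩
    · rw [hbad, Finset.mem_filter]
      refine ⟨ha, fun hcorea => Finset.mem_compl.1 hx ?_⟩
      rw [hR, Finset.mem_image]
      have hx' : (a : G ⧸ H) * q (σ ((a : G ⧸ H)⁻¹ * x)) = x := by simp [hq]
      refine ⟨⟨σ ((a : G ⧸ H)⁻¹ * x), a⟩, ?_, hx'⟩
      simp only [Finset.mem_sigma, Finset.mem_univ, true_and, hS, Finset.mem_filter]
      refine ⟨ha, hcorea, fun b hb => ?_⟩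
      rw [hx']
      exact hamin b hb
    · intro w hw
      obtain ⟨b, hb, rfl⟩ := Finset.mem_image.1 hw
      exact hamin b hb
  have huM : ∀ x, |u x| ≤ 2 * M := fun x => by
    have := abs_sub (f (x.out • y)) (c f)
    simp only [hu]
    linarith [hM f hf (x.out • y), hcM f hf]
  have h1 : |∑ x ∈ Rᶜ, u x| ≤ ε / 3 * n := by
    calc _ ≤ ∑ x ∈ Rᶜ, |u x| := Finset.abs_sum_le_sum_abs _ _
      _ ≤ ∑ x ∈ Rᶜ, 2 * M := Finset.sum_le_sum fun x _ => huM x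
      _ = (Rᶜ).card * (2 * M) := by simp
      _ ≤ ε / (6 * M) * n * (2 * M) := by gcongr
      _ = ε / 3 * n := by field_simp; ring
  have hval : ∀ i, ∀ a ∈ S i, |u ((a : G ⧸ H) * q i) - (f (a • z i) - c f)| ≤ ε / 3 := by
    intro i a ha
    have h := hyS i (a * (q i).out) (Finset.mul_mem_mul ha (Finset.mem_singleton_self _))
    rw [mul_smul, smul_inv_smul, dist_comm] at h
    have hrep : (a : G ⧸ H) * q i = ((a * (q i).out : G) : G ⧸ H) := by
      rw [QuotientGroup.mk_mul, hqout]
    simp only [hu]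
    rw [hrep, out_smul_eq_smul hyH]
    rw [sub_sub_sub_cancel_right]
    exact hδt f hf _ _ h
  have h2 : |∑ x ∈ R, u x - ∑ i, ∑ a ∈ S i, (f (a • z i) - c f)| ≤ ε / 3 * n := by
    rw [hRsum, ← Finset.sum_sub_distrib]
    simp only [← Finset.sum_sub_distrib]
    calc _ ≤ ∑ i, ∑ a ∈ S i, |u ((a : G ⧸ H) * q i) - (f (a • z i) - c f)| :=
          (Finset.abs_sum_le_sum_abs _ _).trans
            (Finset.sum_le_sum fun i _ => Finset.abs_sum_le_sum_abs _ _)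
      _ ≤ ∑ i, ∑ a ∈ S i, ε / 3 :=
          Finset.sum_le_sum fun i _ => Finset.sum_le_sum fun a ha => hval i a ha
      _ = ∑ x ∈ R, ε / 3 := (hRsum fun _ => ε / 3).symm
      _ = R.card * (ε / 3) := by simp
      _ ≤ n * (ε / 3) := by gcongr; exact Finset.card_le_univ _
      _ = _ := by ring
  have h3 : |∑ x, u x| ≤ ε * n := by
    rw [← Finset.sum_add_sum_compl R u]
    have hz3 := hz' f hf
    rw [abs_le] at *
    constructor <;> linarith
  rw [husum, abs_mul, abs_of_pos hn0, mul_comm] at h3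
  exact le_of_mul_le_mul_right h3 hn0

/-- Periodic measures are dense in the invariant measures, for a continuous action with
the specification property of an infinite countable discrete residually finite amenable
group on a compact metric space, in the weak* topology. -/
theorem periodicProbs_dense_in_invariantProbs
    {G X : Type*} [Group G] [Countable G] [Infinite G] [DecidableEq G]
    [MetricSpace X] [CompactSpace X] [MeasurableSpace X] [BorelSpace X]
    [MulAction G X] [ContinuousConstSMul G X]
    (hRF : IsResiduallyFinite G) (hAm : IsAmenableGroup G)
    (hSpec : HasSpecificationDist G X dist) :
    ∀ μ ∈ invariantProbs G X, μ ∈ closure (periodicProbs G X) := by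
  classical
  intro μ hμ
  choose ν hν hνμ using fun p : Finset (BoundedContinuousFunction X ℝ) × ℕ =>
    exists_periodicProbs_integral_close hRF hAm hSpec hμ p.1
      (ε := 1 / ((p.2 : ℝ) + 1)) (by positivity)
  refine mem_closure_of_tendsto (f := ν) (b := atTop) ?_ (Eventually.of_forall hν)
  rw [ProbabilityMeasure.tendsto_iff_forall_integral_tendsto]
  intro f
  rw [tendsto_iff_dist_tendsto_zero]
  have hlim : Tendsto (fun p : Finset (BoundedContinuousFunction X ℝ) × ℕ =>
      1 / ((p.2 : ℝ) + 1)) atTop (𝓝 0) := by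
    rw [← prod_atTop_atTop_eq]
    exact tendsto_one_div_add_atTop_nhds_zero_nat.comp tendsto_snd
  refine squeeze_zero' (Eventually.of_forall fun _ => dist_nonneg) ?_ hlim
  filter_upwards [eventually_ge_atTop (({f} : Finset _), 0)] with p hp
  exact hνμ p f (hp.1 (Finset.mem_singleton_self f))
end

section
/- Let Γ be a countable discrete group and let f ∈ ℤΓ be invertible in ℓ¹(Γ,ℝ). Then the left shift action α_f of Γ on X_f has the specification property. -/
open scoped Pointwise
open Filter Topology

noncomputable section

/-- The circle `ℝ/ℤ`. -/
abbrev Tcirc : Type := AddCircle (1 : ℝ)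

/-- For `f = Σ_s f_s s ∈ ℤΓ` (as a finitely supported function `Γ →₀ ℤ`), the value at `t`
of `r_{f*} x`, where `f* = Σ_s f_s s⁻¹` and `(r^s x)_t = x_{t s}`; explicitly
`(r_{f*} x)_t = Σ_s f_s x_{t s⁻¹}`. -/
def rStarApply {Γ : Type*} [Group Γ] (f : Γ →₀ ℤ) (x : Γ → Tcirc) (t : Γ) : Tcirc :=
  f.sum fun s c => c • x (t * s⁻¹)

/-- `X_f = {x ∈ (ℝ/ℤ)^Γ : r_{f*} x = 0}`, as a (closed, shift-invariant) additive
subgroup of `(ℝ/ℤ)^Γ`. -/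
def XfSub {Γ : Type*} [Group Γ] (f : Γ →₀ ℤ) : AddSubgroup (Γ → Tcirc) where
  carrier := {x | ∀ t, rStarApply f x t = 0}
  zero_mem' := by
    intro t
    simp [rStarApply]
  add_mem' := by
    intro a b ha hb t
    have h : rStarApply f (a + b) t = rStarApply f a t + rStarApply f b t := by
      simp [rStarApply, Finsupp.sum, smul_add, Finset.sum_add_distrib]
    rw [h, ha t, hb t, add_zero]
  neg_mem' := by
    intro a ha t
    have h : rStarApply f (-a) t = -rStarApply f a t := by
      simp [rStarApply, Finsupp.sum]
    rw [h, ha t, neg_zero]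

/-- The left-shift action `α_f` of `Γ` on `X_f`: `(s • x)_t = x_{s⁻¹ t}`. -/
instance {Γ : Type*} [Group Γ] (f : Γ →₀ ℤ) : MulAction Γ (XfSub f) where
  smul s x := ⟨fun t => (x : Γ → Tcirc) (s⁻¹ * t), by
    intro t
    have h := x.2 (s⁻¹ * t)
    simpa [rStarApply, mul_assoc] using h⟩
  one_smul x := Subtype.ext (funext fun t => by
    show (x : Γ → Tcirc) ((1 : Γ)⁻¹ * t) = (x : Γ → Tcirc) t
    rw [inv_one, one_mul])
  mul_smul s₁ s₂ x := Subtype.ext (funext fun t => by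
    show (x : Γ → Tcirc) ((s₁ * s₂)⁻¹ * t) = (x : Γ → Tcirc) (s₂⁻¹ * (s₁⁻¹ * t))
    rw [mul_inv_rev, mul_assoc])

@[simp] lemma smul_XfSub_apply {Γ : Type*} [Group Γ] (f : Γ →₀ ℤ) (s : Γ) (x : XfSub f)
    (t : Γ) : ((s • x : XfSub f) : Γ → Tcirc) t = (x : Γ → Tcirc) (s⁻¹ * t) := rfl

/-- The convolution of two functions on `Γ`: `(u ⋆ v) t = Σ_s u s · v (s⁻¹ t)`. -/
def l1conv {Γ : Type*} [Group Γ] (u v : Γ → ℝ) : Γ → ℝ :=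
  fun t => ∑' s, u s * v (s⁻¹ * t)

/-- The identity of convolution: the indicator of `{1}`. -/
def deltaOne (Γ : Type*) [Group Γ] [DecidableEq Γ] : Γ → ℝ :=
  fun t => if t = 1 then 1 else 0

/-- `g ∈ ℓ¹(Γ,ℝ)` is a two-sided convolution inverse of `f ∈ ℤΓ`. -/
def IsL1Inverse {Γ : Type*} [Group Γ] [DecidableEq Γ] (f : Γ →₀ ℤ) (g : Γ → ℝ) : Prop :=
  Summable (fun s => |g s|) ∧
    l1conv (fun s => (f s : ℝ)) g = deltaOne Γ ∧
    l1conv g (fun s => (f s : ℝ)) = deltaOne Γ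

/-- `f ∈ ℤΓ` is invertible in `ℓ¹(Γ,ℝ)`. -/
def L1Invertible {Γ : Type*} [Group Γ] [DecidableEq Γ] (f : Γ →₀ ℤ) : Prop :=
  ∃ g : Γ → ℝ, IsL1Inverse f g

/-- The distance function of an explicitly given metric space structure. -/
def mdist {X : Type*} (m : MetricSpace X) : X → X → ℝ :=
  m.toPseudoMetricSpace.toDist.dist

/-- The topology induced by an explicitly given metric space structure. -/
def mtop {X : Type*} (m : MetricSpace X) : TopologicalSpace X :=
  m.toPseudoMetricSpace.toUniformSpace.toTopologicalSpace

end

lemma summable_mul_of_abs_le {α : Type*} {g a : α → ℝ} (hg : Summable fun s => |g s|) {M : ℝ}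
    (ha : ∀ t, |a t| ≤ M) (φ ψ : α → α) (hψ : Function.Injective ψ) :
    Summable fun u => a (φ u) * g (ψ u) := by
  refine Summable.of_norm_bounded ((hg.comp_injective hψ).mul_left M) fun u => ?_
  rw [Real.norm_eq_abs, abs_mul]
  exact mul_le_mul_of_nonneg_right (ha _) (abs_nonneg _)

section

variable {Γ : Type*} [Group Γ]

/-- Right convolution of a function on `Γ` with `g`, written so that it is absolutely
convergent for bounded `a` and summable `g`. -/
noncomputable def rightConv (g a : Γ → ℝ) (t : Γ) : ℝ := ∑' u, a (t * u⁻¹) * g u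

lemma l1conv_finsupp_left (f : Γ →₀ ℤ) (g : Γ → ℝ) (v : Γ) :
    l1conv (fun s => (f s : ℝ)) g v = ∑ s ∈ f.support, (f s : ℝ) * g (s⁻¹ * v) := by
  refine tsum_eq_sum fun s hs => ?_
  simp [Finsupp.notMem_support_iff.mp hs]

lemma l1conv_finsupp_right (f : Γ →₀ ℤ) (g : Γ → ℝ) (v : Γ) :
    l1conv g (fun s => (f s : ℝ)) v = ∑ s ∈ f.support, (f s : ℝ) * g (v * s⁻¹) := by
  let e : Γ ≃ Γ := (Equiv.inv Γ).trans (Equiv.mulLeft v)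
  rw [l1conv, ← e.tsum_eq]
  have h : ∀ s, g (e s) * (f ((e s)⁻¹ * v) : ℝ) = (f s : ℝ) * g (v * s⁻¹) := fun s => by
    simp [e, mul_comm]
  simp_rw [h]
  refine tsum_eq_sum fun s hs => ?_
  simp [Finsupp.notMem_support_iff.mp hs]

lemma tsum_mul_deltaOne [DecidableEq Γ] (a : Γ → ℝ) (t : Γ) :
    ∑' v, a (t * v⁻¹) * deltaOne Γ v = a t := by
  rw [tsum_eq_single 1]
  · simp [deltaOne]
  · intro v hv
    simp [deltaOne, hv]

/-- Convolving with `f` and then with its right inverse `g` gives the original function back. -/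
lemma rightConv_sum_eq [DecidableEq Γ] {f : Γ →₀ ℤ} {g a : Γ → ℝ} (hg : Summable fun s => |g s|)
    (hfg : l1conv (fun s => (f s : ℝ)) g = deltaOne Γ) {M : ℝ} (ha : ∀ t, |a t| ≤ M) (t : Γ) :
    rightConv g (fun w => ∑ s ∈ f.support, (f s : ℝ) * a (w * s⁻¹)) t = a t := by
  have hshift : ∀ s, (∑' u, a (t * u⁻¹ * s⁻¹) * g u) = ∑' v, a (t * v⁻¹) * g (s⁻¹ * v) :=
    fun s => by
      rw [← (Equiv.mulLeft s).tsum_eq fun v => a (t * v⁻¹) * g (s⁻¹ * v)]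
      simp [mul_assoc]
  calc
    _ = ∑' u, ∑ s ∈ f.support, (f s : ℝ) * (a (t * u⁻¹ * s⁻¹) * g u) := by
      simp only [rightConv, Finset.sum_mul, mul_assoc]
    _ = ∑ s ∈ f.support, (f s : ℝ) * ∑' v, a (t * v⁻¹) * g (s⁻¹ * v) := by
      rw [Summable.tsum_finsetSum fun s _ => (summable_mul_of_abs_le hg ha
        (fun u => t * u⁻¹ * s⁻¹) (fun u => u) Function.injective_id).mul_left _]
      simp_rw [tsum_mul_left, hshift]
    _ = ∑' v, a (t * v⁻¹) * l1conv (fun s => (f s : ℝ)) g v := by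
      simp_rw [l1conv_finsupp_left, Finset.mul_sum, mul_left_comm (a _)]
      rw [Summable.tsum_finsetSum fun s _ => (summable_mul_of_abs_le hg ha
        (fun v => t * v⁻¹) (fun v => s⁻¹ * v) (mul_right_injective _)).mul_left _]
      simp_rw [tsum_mul_left]
    _ = a t := by rw [hfg, tsum_mul_deltaOne]

/-- Convolving with a left inverse `g` of `f` and then with `f` gives the original function
back. -/
lemma sum_rightConv_eq [DecidableEq Γ] {f : Γ →₀ ℤ} {g a : Γ → ℝ} (hg : Summable fun s => |g s|)
    (hgf : l1conv g (fun s => (f s : ℝ)) = deltaOne Γ) {M : ℝ} (ha : ∀ t, |a t| ≤ M) (t : Γ) :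
    ∑ s ∈ f.support, (f s : ℝ) * rightConv g a (t * s⁻¹) = a t := by
  have hshift : ∀ s, rightConv g a (t * s⁻¹) = ∑' v, a (t * v⁻¹) * g (v * s⁻¹) :=
    fun s => by
      rw [← (Equiv.mulRight s).tsum_eq fun v => a (t * v⁻¹) * g (v * s⁻¹)]
      simp [rightConv, mul_assoc]
  calc
    _ = ∑' v, a (t * v⁻¹) * l1conv g (fun s => (f s : ℝ)) v := by
      simp_rw [l1conv_finsupp_right, Finset.mul_sum, mul_left_comm (a _)]
      rw [Summable.tsum_finsetSum fun s _ => (summable_mul_of_abs_le hg ha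
        (fun v => t * v⁻¹) (fun v => v * s⁻¹) (mul_left_injective _)).mul_left _]
      simp_rw [tsum_mul_left, hshift]
    _ = a t := by rw [hgf, tsum_mul_deltaOne]

lemma rStarApply_coe (f : Γ →₀ ℤ) (a : Γ → ℝ) (t : Γ) :
    rStarApply f (fun w => (a w : Tcirc)) t
      = ((∑ s ∈ f.support, (f s : ℝ) * a (t * s⁻¹) : ℝ) : Tcirc) := by
  rw [rStarApply, Finsupp.sum, ← QuotientAddGroup.mk'_apply, map_sum]
  refine Finset.sum_congr rfl fun s _ => ?_
  rw [← zsmul_eq_mul, map_zsmul]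
  rfl

lemma exists_intCast_of_coe_eq_zero {r : ℝ} (h : (r : Tcirc) = 0) : ∃ n : ℤ, (n : ℝ) = r := by
  obtain ⟨n, hn⟩ := (AddCircle.coe_eq_zero_iff (1 : ℝ)).mp h
  exact ⟨n, by simpa using hn⟩

lemma coe_rightConv_mem_XfSub [DecidableEq Γ] {f : Γ →₀ ℤ} {g : Γ → ℝ}
    (hg : IsL1Inverse f g) {h : Γ → ℤ} {M : ℝ} (hM : ∀ t, |(h t : ℝ)| ≤ M) :
    (fun t => (rightConv g (fun s => (h s : ℝ)) t : Tcirc)) ∈ XfSub f := by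
  intro t
  rw [rStarApply_coe, sum_rightConv_eq (a := fun s => (h s : ℝ)) hg.1 hg.2.2 hM]
  exact (AddCircle.coe_eq_zero_iff (1 : ℝ)).mpr ⟨h t, by simp⟩

/-- Every point of `X_f` is the reduction modulo `ℤ` of the convolution of the inverse of `f`
with an integer-valued function bounded by the `ℓ¹` norm of `f`. -/
lemma exists_eq_coe_rightConv [DecidableEq Γ] {f : Γ →₀ ℤ} {g : Γ → ℝ}
    (hg : IsL1Inverse f g) (x : XfSub f) :
    ∃ h : Γ → ℤ, (∀ t, |(h t : ℝ)| ≤ ∑ s ∈ f.support, |(f s : ℝ)|) ∧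
      ∀ t, (x : Γ → Tcirc) t = (rightConv g (fun s => (h s : ℝ)) t : Tcirc) := by
  have hlift : ∀ t, ∃ r : ℝ, |r| ≤ 1 ∧ (r : Tcirc) = (x : Γ → Tcirc) t := fun t => by
    obtain ⟨r, hr⟩ := QuotientAddGroup.mk_surjective ((x : Γ → Tcirc) t)
    refine ⟨Int.fract r, ?_, ?_⟩
    · rw [abs_of_nonneg (Int.fract_nonneg r)]
      exact (Int.fract_lt_one r).le
    · rw [← hr, ← sub_eq_zero]
      change ((Int.fract r : ℝ) : Tcirc) - ((r : ℝ) : Tcirc) = 0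
      rw [← AddCircle.coe_sub, AddCircle.coe_eq_zero_iff]
      exact ⟨-⌊r⌋, by rw [← Int.self_sub_floor]; simp⟩
  choose a ha hax using hlift
  have hx : (fun w => (a w : Tcirc)) = (x : Γ → Tcirc) := funext hax
  have hint : ∀ t, ∃ n : ℤ, (n : ℝ) = ∑ s ∈ f.support, (f s : ℝ) * a (t * s⁻¹) := fun t => by
    refine exists_intCast_of_coe_eq_zero ?_
    rw [← rStarApply_coe, hx]
    exact x.2 t
  choose h hh using hint
  refine ⟨h, fun t => ?_, fun t => ?_⟩
  · rw [hh]
    refine (Finset.abs_sum_le_sum_abs _ _).trans (Finset.sum_le_sum fun s _ => ?_)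
    rw [abs_mul]
    exact mul_le_of_le_one_right (abs_nonneg _) (ha _)
  · simp_rw [hh]
    rw [rightConv_sum_eq hg.1 hg.2.1 ha, hax]

/-- For bounded functions that agree on `t E⁻¹`, convolutions with `g` at `t` are close when `E`
carries most of the mass of `g`. -/
lemma exists_finset_abs_rightConv_sub_lt {g : Γ → ℝ} (hg : Summable fun s => |g s|) (M : ℝ) {δ : ℝ}
    (hδ : 0 < δ) :
    ∃ E : Finset Γ, ∀ a b : Γ → ℝ, (∀ t, |a t| ≤ M) → (∀ t, |b t| ≤ M) →
      ∀ t, (∀ u ∈ E, a (t * u⁻¹) = b (t * u⁻¹)) → |rightConv g a t - rightConv g b t| < δ := by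
  have hs : Summable fun u => 2 * M * |g u| := hg.mul_left _
  obtain ⟨E, hE⟩ := (((tendsto_order.1 (tendsto_tsum_compl_atTop_zero
    fun u => 2 * M * |g u|)).2 δ hδ).exists)
  refine ⟨E, fun a b ha hb t hab => lt_of_le_of_lt ?_ hE⟩
  have hsa := summable_mul_of_abs_le hg ha (fun u => t * u⁻¹) (fun u => u) Function.injective_id
  have hsb := summable_mul_of_abs_le hg hb (fun u => t * u⁻¹) (fun u => u) Function.injective_id
  have hsupp : Function.support (fun u => a (t * u⁻¹) * g u - b (t * u⁻¹) * g u)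
      ⊆ {u | u ∉ E} := by
    intro u hu huE
    exact hu (by simp [hab u huE])
  rw [rightConv, rightConv, ← hsa.tsum_sub hsb, ← tsum_subtype_eq_of_support_subset hsupp,
    ← Real.norm_eq_abs]
  refine tsum_of_norm_bounded (hs.subtype _).hasSum fun u => ?_
  rw [Function.comp_apply, ← sub_mul, Real.norm_eq_abs, abs_mul]
  refine mul_le_mul_of_nonneg_right ?_ (abs_nonneg _)
  linarith [abs_sub (a (t * (u : Γ)⁻¹)) (b (t * (u : Γ)⁻¹)), ha (t * (u : Γ)⁻¹),
    hb (t * (u : Γ)⁻¹)]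

lemma isClosed_XfSub (f : Γ →₀ ℤ) : IsClosed (XfSub f : Set (Γ → Tcirc)) := by
  have h : (XfSub f : Set (Γ → Tcirc)) = ⋂ t, {x | rStarApply f x t = 0} := by
    ext x
    simp only [Set.mem_iInter]
    rfl
  rw [h]
  refine isClosed_iInter fun t => isClosed_eq ?_ continuous_const
  unfold rStarApply Finsupp.sum
  fun_prop

/-- A compatible metric on `X_f` is uniformly controlled by finitely many coordinates. -/
lemma exists_finset_mdist_lt {f : Γ →₀ ℤ} (m : MetricSpace (XfSub f))
    (hm : mtop m = inferInstanceAs (TopologicalSpace (XfSub f))) {ε : ℝ} (hε : 0 < ε) :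
    ∃ (K : Finset Γ) (δ : ℝ), 0 < δ ∧ ∀ x y : XfSub f,
      (∀ t ∈ K, dist ((x : Γ → Tcirc) t) ((y : Γ → Tcirc) t) < δ) → mdist m x y < ε := by
  have : Fact ((0 : ℝ) < 1) := ⟨one_pos⟩
  have : CompactSpace (XfSub f) :=
    isCompact_iff_compactSpace.mp (isClosed_XfSub f).isCompact
  have huc : @UniformContinuous (XfSub f) (XfSub f) _ m.toPseudoMetricSpace.toUniformSpace id :=
    @CompactSpace.uniformContinuous_of_continuous (XfSub f) (XfSub f) _
      m.toPseudoMetricSpace.toUniformSpace _ id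
      (continuous_id_iff_le.mpr (le_of_eq (show _ = mtop m from hm.symm)))
  have hmem : {p : XfSub f × XfSub f | mdist m p.1 p.2 < ε} ∈ uniformity (XfSub f) :=
    huc (@Metric.dist_mem_uniformity _ m.toPseudoMetricSpace ε hε)
  have hbasis := HasBasis.iInf' fun t : Γ =>
    (Metric.uniformity_basis_dist (α := Tcirc)).comap
      fun p : (Γ → Tcirc) × (Γ → Tcirc) => (p.1 t, p.2 t)
  rw [← Pi.uniformity] at hbasis
  rw [uniformity_subtype, (hbasis.comap _).mem_iff] at hmem
  obtain ⟨⟨K, δ⟩, ⟨hKfin, hδ⟩, hsub⟩ := hmem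
  obtain ⟨δ₀, hδ₀, hle⟩ : ∃ δ₀ > 0, ∀ t ∈ K, δ₀ ≤ δ t := by
    rcases K.eq_empty_or_nonempty with rfl | hne
    · exact ⟨1, one_pos, by simp⟩
    · obtain ⟨t₀, ht₀, hmin⟩ := hKfin.exists_minimalFor δ K hne
      exact ⟨δ t₀, hδ t₀ ht₀, fun t ht => (le_total _ _).elim id (hmin ht)⟩
  refine ⟨hKfin.toFinset, δ₀, hδ₀, fun x y hxy => hsub (a := (x, y)) ?_⟩
  simp only [Set.mem_preimage, Set.mem_iInter]
  exact fun t ht => (hxy t (hKfin.mem_toFinset.mpr ht)).trans_le (hle t ht)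

/-- Blocks of integer configurations that are far apart relative to `L L⁻¹` extend to one
`G'`-invariant configuration. -/
lemma exists_invariant_glue [DecidableEq Γ] {M : ℝ} (hM : 0 ≤ M) (L : Finset Γ) {n : ℕ}
    (Fs : Fin n → Finset Γ) (G' : Subgroup Γ)
    (hsep : ∀ i j, ∀ a ∈ Fs i, ∀ b ∈ Fs j, ∀ l ∈ L, ∀ l' ∈ L, ∀ γ ∈ G',
      l' * l⁻¹ * a = b * γ → γ = 1 ∧ i = j)
    (h : Fin n → Γ → ℤ) (hh : ∀ i t, |(h i t : ℝ)| ≤ M) :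
    ∃ k : Γ → ℤ, (∀ t, |(k t : ℝ)| ≤ M) ∧ (∀ γ ∈ G', ∀ t, k (γ * t) = k t) ∧
      ∀ i, ∀ a ∈ Fs i, ∀ l ∈ L, k (a⁻¹ * l) = h i (a⁻¹ * l) := by
  classical
  let P : Γ → Γ → Fin n → Prop := fun t γ i =>
    γ ∈ G' ∧ ∃ a ∈ Fs i, ∃ l ∈ L, t = γ * (a⁻¹ * l)
  have huniq : ∀ t γ i γ' j, P t γ i → P t γ' j → γ = γ' ∧ i = j := by
    rintro t γ i γ' j ⟨hγ, a, ha, l, hl, rfl⟩ ⟨hγ', b, hb, l', hl', ht⟩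
    have := hsep i j a ha b hb l hl l' hl' (γ'⁻¹ * γ) (G'.mul_mem (G'.inv_mem hγ') hγ) (by
      have : l' = b * γ'⁻¹ * (γ * (a⁻¹ * l)) := by rw [ht]; group
      rw [this]; group)
    exact ⟨(inv_mul_eq_one.mp this.1).symm, this.2⟩
  let k : Γ → ℤ := fun t =>
    if ht : ∃ p : Γ × Fin n, P t p.1 p.2 then h ht.choose.2 (ht.choose.1⁻¹ * t) else 0
  have hk : ∀ t γ i, P t γ i → k t = h i (γ⁻¹ * t) := by
    intro t γ i hP
    have ht : ∃ p : Γ × Fin n, P t p.1 p.2 := ⟨(γ, i), hP⟩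
    obtain ⟨h1, h2⟩ := huniq _ _ _ _ _ ht.choose_spec hP
    simp only [k, dif_pos ht, h1, h2]
  have hk0 : ∀ t, (¬ ∃ p : Γ × Fin n, P t p.1 p.2) → k t = 0 := fun t ht => dif_neg ht
  have hPmul : ∀ t γ i, ∀ γ' ∈ G', P t γ i → P (γ' * t) (γ' * γ) i := by
    rintro t γ i γ' hγ' ⟨hγ, a, ha, l, hl, rfl⟩
    exact ⟨G'.mul_mem hγ' hγ, a, ha, l, hl, by group⟩
  refine ⟨k, fun t => ?_, fun γ hγ t => ?_, fun i a ha l hl => ?_⟩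
  · by_cases ht : ∃ p : Γ × Fin n, P t p.1 p.2
    · obtain ⟨p, hp⟩ := ht
      rw [hk t _ _ hp]
      exact hh _ _
    · simpa [hk0 t ht] using hM
  · by_cases ht : ∃ p : Γ × Fin n, P t p.1 p.2
    · obtain ⟨p, hp⟩ := ht
      rw [hk t _ _ hp, hk _ _ _ (hPmul _ _ _ γ hγ hp)]
      congr 1
      group
    · rw [hk0 t ht, hk0]
      rintro ⟨p, hp⟩
      refine ht ⟨(γ⁻¹ * p.1, p.2), ?_⟩
      simpa using hPmul _ _ _ _ (G'.inv_mem hγ) hp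
  · simpa using hk (a⁻¹ * l) 1 i ⟨G'.one_mem, a, ha, l, hl, by simp⟩

end

/-- For `f ∈ ℤΓ` invertible in `ℓ¹(Γ,ℝ)`, the left-shift action `α_f` of `Γ` on `X_f`
has the specification property (with respect to any compatible metric on `X_f`). -/
theorem Xf_hasSpecification {Γ : Type*} [Group Γ] [Countable Γ] [DecidableEq Γ]
    (f : Γ →₀ ℤ) (hf : L1Invertible f)
    (m : MetricSpace (XfSub f)) (hm : mtop m = inferInstanceAs (TopologicalSpace (XfSub f))) :
    HasSpecificationDist Γ (XfSub f) (mdist m) := by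
  obtain ⟨g, hg⟩ := hf
  intro ε hε
  obtain ⟨K, δ, hδ, hK⟩ := exists_finset_mdist_lt m hm hε
  set M : ℝ := ∑ s ∈ f.support, |(f s : ℝ)| with hM
  obtain ⟨E, hE⟩ := exists_finset_abs_rightConv_sub_lt hg.1 M hδ
  let L : Finset Γ := K * E⁻¹
  refine ⟨insert 1 (L * L⁻¹), Finset.insert_nonempty _ _, fun n Fs hFs G' hG' x => ?_⟩
  choose h hhM hhx using fun i => exists_eq_coe_rightConv hg (x i)
  have hsep : ∀ i j, ∀ a ∈ Fs i, ∀ b ∈ Fs j, ∀ l ∈ L, ∀ l' ∈ L, ∀ γ ∈ G',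
      l' * l⁻¹ * a = b * γ → γ = 1 ∧ i = j := by
    intro i j a ha b hb l hl l' hl' γ hγ heq
    have hmem : l' * l⁻¹ * a ∈ insert 1 (L * L⁻¹) * Fs i :=
      Finset.mul_mem_mul (Finset.mem_insert_of_mem
        (Finset.mul_mem_mul hl' (Finset.inv_mem_inv hl))) ha
    have hγ1 : γ = 1 := by
      by_contra hne
      exact Set.disjoint_left.mp (hG' i j) (Finset.mem_coe.mpr hmem)
        (heq ▸ Set.mul_mem_mul hb ⟨hγ, hne⟩)
    refine ⟨hγ1, ?_⟩
    by_contra hij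
    exact Finset.disjoint_left.mp (hFs i j hij) hmem (by rwa [heq, hγ1, mul_one])
  obtain ⟨k, hkM, hkG, hkh⟩ := exists_invariant_glue
    (Finset.sum_nonneg fun _ _ => abs_nonneg _) L Fs G' hsep h hhM
  refine ⟨⟨_, coe_rightConv_mem_XfSub hg hkM⟩, fun i s hs => (hK _ _ fun t ht => ?_).le,
    fun s hs => Subtype.ext (funext fun t => ?_)⟩
  · rw [smul_XfSub_apply, smul_XfSub_apply, hhx, dist_eq_norm, ← AddCircle.coe_sub]
    refine (QuotientAddGroup.norm_mk_le_norm).trans_lt ?_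
    refine hE _ _ (hhM i) hkM _ fun u hu => ?_
    rw [mul_assoc, hkh i s hs _ (Finset.mul_mem_mul ht (Finset.inv_mem_inv hu))]
  · rw [smul_XfSub_apply]
    simp only [rightConv, mul_assoc, hkG _ (G'.inv_mem hs)]
end

section
/- Let α be an expansive continuous action of a countable discrete group Γ on a compact metric space (X,ρ), and let d > 0 be an expansive constant: if x, y ∈ X satisfy sup_{s ∈ Γ} ρ(sx, sy) ≤ d then x = y. Suppose x, y ∈ X satisfy ρ(sx, sy) ≤ d for all but finitely many s ∈ Γ. Then ρ(sx, sy) → 0 as s → ∞ in Γ, i.e., for every δ > 0 the set {s ∈ Γ : ρ(sx, sy) ≥ δ} is finite. -/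
/-- For an expansive continuous action of a countable discrete group `Γ` on a compact
metric space `X` with expansive constant `d`, if two points satisfy `ρ(sx, sy) ≤ d` for
all but finitely many `s ∈ Γ`, then `ρ(sx, sy) → 0` as `s → ∞` in `Γ`: for every `δ > 0`
the set `{s : ρ(sx, sy) ≥ δ}` is finite. -/
theorem dist_tendsto_zero_of_expansive {Γ X : Type*} [Group Γ] [Countable Γ]
    [MetricSpace X] [CompactSpace X] [MulAction Γ X] [ContinuousConstSMul Γ X]
    (d : ℝ) (hd : 0 < d)
    (hexp : ∀ x y : X, (∀ s : Γ, dist (s • x) (s • y) ≤ d) → x = y)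
    (x y : X) (hxy : {s : Γ | d < dist (s • x) (s • y)}.Finite) :
    ∀ δ : ℝ, 0 < δ → {s : Γ | δ ≤ dist (s • x) (s • y)}.Finite := by
  intro δ hδ
  by_contra hinf
  have : (Filter.cofinite ⊓ Filter.principal {s : Γ | δ ≤ dist (s • x) (s • y)}).NeBot :=
    Filter.cofinite_inf_principal_neBot_iff.2 hinf
  obtain ⟨U, hU⟩ := Ultrafilter.exists_le
    (Filter.cofinite ⊓ Filter.principal {s : Γ | δ ≤ dist (s • x) (s • y)})
  obtain ⟨a, -, ha⟩ := isCompact_univ.ultrafilter_le_nhds (U.map fun s : Γ => s • x) (by simp)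
  obtain ⟨b, -, hb⟩ := isCompact_univ.ultrafilter_le_nhds (U.map fun s : Γ => s • y) (by simp)
  have hax : Filter.Tendsto (fun s : Γ => s • x) U (nhds a) := ha
  have hby : Filter.Tendsto (fun s : Γ => s • y) U (nhds b) := hb
  have hab : a = b := by
    refine hexp a b fun t => le_of_tendsto ((hax.const_smul t).dist (hby.const_smul t)) ?_
    have hcof : ∀ᶠ s : Γ in Filter.cofinite, dist (s • x) (s • y) ≤ d := by
      simpa [Filter.eventually_cofinite] using hxy
    have hmul := (mul_right_injective t).tendsto_cofinite.eventually hcof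
    filter_upwards [(hU.trans inf_le_left) hmul] with s hs
    simpa only [Set.mem_ofPred_eq, mul_smul] using hs
  have hle : δ ≤ dist a b := ge_of_tendsto (hax.dist hby)
    ((hU.trans inf_le_right) (Filter.mem_principal_self _))
  rw [hab, dist_self] at hle
  exact hδ.not_ge hle
end
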